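/- Central limit theorem for the number of branches of general order: for every fixed order r ≥ 1, the random variables √n·(S_{r+1,n}/n − 1/4^r) converge in distribution, as n → ∞, to the normal distribution N(0, (4^r − 1)/(3·16^r)). -/

import Mathlib

open MeasureTheory ProbabilityTheory Filter
open scoped NNReal Topology

/-- Binary trees: every internal node has exactly two children. -/
inductive BinTree : Type
  | leaf : BinTree
  | node : BinTree → BinTree → BinTree
  deriving DecidableEq

namespace BinTree

/-- The magnitude of a binary tree is its number of leaves. -/
def magnitude : BinTree → ℕ
  | leaf => 1
  | node l r => magnitude l + magnitude r

/-- The Horton–Strahler order of (the root of) a binary tree: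
leaves have order 1; a node whose two children have distinct orders has the max of the two;
a node whose two children have equal order `r` has order `r + 1`. -/
def ord : BinTree → ℕ
  | leaf => 1
  | node l r => if ord l = ord r then ord l + 1 else max (ord l) (ord r)

/-- `branches k τ` is `S_{k,n}(τ)`, the number of Horton–Strahler branches of order `k`
in `τ`, i.e. the number of maximal connected paths of nodes of order `k`.  It counts the
nodes of order `k` that head a branch: a new branch head of order `ord l + 1` is created
exactly at a node whose two children have equal order `ord l`, and every leaf heads an
order-1 branch. -/
def branches (k : ℕ) : BinTree → ℕ
  | leaf => if k = 1 then 1 else 0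
  | node l r => branches k l + branches k r +
      (if ord l = ord r ∧ ord l + 1 = k then 1 else 0)

end BinTree

/-- `treesOf n` is the finite set `Ω_n` of binary trees of magnitude `n`. -/
def treesOf : ℕ → Finset BinTree
  | 0 => ∅
  | 1 => {BinTree.leaf}
  | (n+2) => (Finset.range (n+1)).attach.biUnion fun k =>
      ((treesOf (k.1+1)) ×ˢ (treesOf (n+1-k.1))).image fun p => BinTree.node p.1 p.2
  decreasing_by
  · have := Finset.mem_range.mp k.2; omega
  · omega

/-- Expectation `⟨f⟩` under the uniform probability measure `P_n` on `Ω_n` (the random model). -/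
noncomputable def expect (n : ℕ) (f : BinTree → ℝ) : ℝ :=
  (∑ τ ∈ treesOf n, f τ) / (treesOf n).card

theorem BinTree.one_le_magnitude (τ : BinTree) : 1 ≤ τ.magnitude := by
  induction τ with
  | leaf => simp [magnitude]
  | node l r hl hr => simp only [magnitude]; omega

open Finset in
theorem mem_treesOf (n : ℕ) (τ : BinTree) : τ ∈ treesOf n ↔ τ.magnitude = n := by
  induction τ generalizing n with
  | leaf =>
    rcases n with _ | _ | n
    · simp [treesOf, BinTree.magnitude]
    · simp [treesOf, BinTree.magnitude]
    · simp [treesOf, BinTree.magnitude]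
  | node l r hl hr =>
    have h1 := l.one_le_magnitude
    have h2 := r.one_le_magnitude
    rcases n with _ | _ | n
    · simp only [treesOf, BinTree.magnitude, notMem_empty, false_iff]; omega
    · simp only [zero_add, treesOf, BinTree.magnitude, mem_singleton, reduceCtorEq, false_iff]; omega
    · simp only [treesOf, mem_biUnion, mem_attach, true_and, mem_image, mem_product, Prod.exists,
        BinTree.node.injEq, Subtype.exists, mem_range, BinTree.magnitude]
      constructor
      · rintro ⟨k, hk, a, b, ⟨ha, hb⟩, rfl, rfl⟩
        have h3 := (hl _).1 ha
        have h4 := (hr _).1 hb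
        omega
      · intro h
        exact ⟨l.magnitude - 1, by omega, l, r, ⟨(hl _).2 (by omega), (hr _).2 (by omega)⟩, rfl, rfl⟩

theorem treesOf_zero : treesOf 0 = ∅ := by simp [treesOf]

theorem treesOf_one : treesOf 1 = {BinTree.leaf} := by simp [treesOf]

open Finset in
theorem sum_treesOf_add_two {M : Type*} [AddCommMonoid M] (n : ℕ) (f : BinTree → M) :
    ∑ τ ∈ treesOf (n + 2), f τ = ∑ p ∈ antidiagonal (n + 2),
      ∑ l ∈ treesOf p.1, ∑ r ∈ treesOf p.2, f (.node l r) := by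
  rw [Finset.Nat.sum_antidiagonal_eq_sum_range_succ_mk, sum_range_succ, sum_range_succ']
  simp only [Nat.sub_self, treesOf_zero, sum_empty, sum_const_zero, add_zero]
  rw [treesOf, sum_biUnion]
  · rw [← sum_attach (range (n + 1))]
    refine sum_congr rfl fun k _ => ?_
    rw [sum_image, sum_product]
    · rw [show n + 2 - (k.1 + 1) = n + 1 - k.1 by omega]
    · rintro ⟨a, b⟩ _ ⟨c, d⟩ _ h
      simpa using h
  · intro i _ j _ hij
    rw [Function.onFun, disjoint_left]
    simp only [mem_image, mem_product, mem_treesOf, not_exists, not_and, forall_exists_index, and_imp]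
    rintro _ p h1 h2 rfl q h3 h4 h5
    rw [BinTree.node.injEq] at h5
    refine hij (Subtype.ext ?_)
    rw [h5.1] at h3
    omega

theorem card_treesOf_succ (n : ℕ) : (treesOf (n + 1)).card = catalan n := by
  induction n using Nat.strong_induction_on with
  | _ n ih =>
    rcases n with _ | n
    · simp [treesOf_one]
    · rw [Finset.card_eq_sum_ones, sum_treesOf_add_two, catalan_succ',
        Finset.Nat.sum_antidiagonal_succ, Finset.Nat.sum_antidiagonal_succ']
      simp only [treesOf_zero, Finset.sum_empty, Finset.sum_const_zero, zero_add]
      refine Finset.sum_congr rfl fun p hp => ?_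
      have hp := Finset.HasAntidiagonal.mem_antidiagonal.1 hp
      simp [ih p.1 (by omega), ih p.2 (by omega)]

namespace BinTree

theorem one_le_ord (τ : BinTree) : 1 ≤ τ.ord := by
  induction τ with
  | leaf => simp [ord]
  | node l r hl hr => rw [ord]; split_ifs <;> omega

/-- Joining two possibly empty trees below a new root, suppressing the root if it does not have
two children; two empty trees are joined to a leaf. -/
def joinPruned : Option BinTree → Option BinTree → Option BinTree
  | none, none => some leaf
  | some a, none => some a
  | none, some b => some b
  | some a, some b => some (node a b)

/-- The tree obtained by removing all the leaves and suppressing the resulting nodes with a single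
child; the empty tree is represented by `none`. -/
def prune : BinTree → Option BinTree
  | leaf => none
  | node l r => joinPruned (prune l) (prune r)

theorem ord_eq_prune (τ : BinTree) : τ.ord = τ.prune.elim 0 ord + 1 := by
  induction τ with
  | leaf => simp [ord, prune]
  | node l r hl hr =>
    rw [ord, hl, hr, prune]
    rcases prune l with _ | a <;> rcases prune r with _ | b <;>
      simp only [joinPruned, Option.elim, ord]
    · simp
    · have := one_le_ord b
      grind
    · have := one_le_ord a
      grind
    · grind

theorem branches_eq_prune (k : ℕ) (τ : BinTree) :
    τ.branches (k + 2) = τ.prune.elim 0 (branches (k + 1)) := by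
  induction τ with
  | leaf => simp [branches, prune]
  | node l r hl hr =>
    rw [branches, hl, hr, ord_eq_prune l, ord_eq_prune r, prune]
    rcases prune l with _ | a <;> rcases prune r with _ | b <;>
      simp only [joinPruned, Option.elim, branches]
    · simp
    · have := one_le_ord b
      grind
    · have := one_le_ord a
      grind
    · grind

theorem branches_one (τ : BinTree) : τ.branches 1 = τ.magnitude := by
  induction τ with
  | leaf => simp [branches, magnitude]
  | node l r hl hr =>
    have := one_le_ord l
    rw [branches, hl, hr, magnitude, if_neg (by omega), add_zero]

theorem prune_eq_none_iff (τ : BinTree) : τ.prune = none ↔ τ = leaf := by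
  rcases τ with _ | ⟨l, r⟩
  · simp [prune]
  · rw [prune]
    rcases prune l with _ | a <;> rcases prune r with _ | b <;> simp [joinPruned]

theorem magnitude_prune_lt {τ σ : BinTree} (h : τ.prune = some σ) :
    σ.magnitude < τ.magnitude := by
  induction τ generalizing σ with
  | leaf => simp [prune] at h
  | node l r hl hr =>
    rw [prune] at h
    have h1 := one_le_magnitude l
    have h2 := one_le_magnitude r
    rcases hl' : prune l with _ | a <;> rcases hr' : prune r with _ | b <;>
      simp only [hl', hr', joinPruned, Option.some.injEq] at h <;> subst h <;>
      simp only [magnitude]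
    · omega
    · have := hr hr'
      omega
    · have := hl hl'
      omega
    · have := hl hl'
      have := hr hr'
      omega

end BinTree

open PowerSeries in
/-- The generating function of a statistic on binary trees, by magnitude. -/
noncomputable def treeGF (f : BinTree → ℤ) : ℤ⟦X⟧ :=
  PowerSeries.mk fun n => ∑ τ ∈ treesOf n, f τ

theorem treeGF_eq (f g₁ h₁ g₂ h₂ g₃ h₃ : BinTree → ℤ) (hf : f .leaf = 0)
    (hn : ∀ l r, f (.node l r) = g₁ l * h₁ r + g₂ l * h₂ r + g₃ l * h₃ r) :
    treeGF f = treeGF g₁ * treeGF h₁ + treeGF g₂ * treeGF h₂ + treeGF g₃ * treeGF h₃ := by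
  ext n
  simp only [map_add, PowerSeries.coeff_mul, treeGF, PowerSeries.coeff_mk]
  rcases n with _ | _ | n
  · simp [treesOf_zero]
  · simp [treesOf_one, hf, Finset.Nat.antidiagonal_succ, treesOf_zero]
  · simp only [sum_treesOf_add_two, ← Finset.sum_add_distrib]
    refine Finset.sum_congr rfl fun p _ => ?_
    simp only [hn, Finset.sum_add_distrib, Finset.sum_mul_sum]

/-- The indicator function of the trees which are pruned to `o`. -/
def pruneIndicator (o : Option BinTree) (τ : BinTree) : ℤ :=
  if τ.prune = o then 1 else 0

open PowerSeries in
/-- The generating function of the trees which are pruned to `o`. -/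
noncomputable def pruneGF (o : Option BinTree) : ℤ⟦X⟧ :=
  treeGF (pruneIndicator o)

open PowerSeries in
theorem pruneGF_none : pruneGF none = X := by
  ext n
  simp only [pruneGF, treeGF, pruneIndicator, coeff_mk, coeff_X, BinTree.prune_eq_none_iff]
  simp [mem_treesOf, BinTree.magnitude, eq_comm]

open PowerSeries in
theorem pruneGF_leaf : pruneGF (some .leaf) =
    X ^ 2 + 2 * X * pruneGF (some .leaf) := by
  have hjoin : ∀ x y : Option BinTree,
      (if BinTree.joinPruned x y = some .leaf then (1 : ℤ) else 0) =
        (if x = none then 1 else 0) * (if y = none then 1 else 0) +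
        (if x = some .leaf then 1 else 0) * (if y = none then 1 else 0) +
        (if x = none then 1 else 0) * (if y = some .leaf then 1 else 0) := by
    rintro (_ | x) (_ | y) <;> simp [BinTree.joinPruned]
  have h : pruneGF (some .leaf) = pruneGF (none) * pruneGF (none) +
      pruneGF (some .leaf) * pruneGF none + pruneGF none * pruneGF (some .leaf) :=
    treeGF_eq _ _ _ _ _ _ _ (by simp [pruneIndicator, BinTree.prune])
      fun l r => by simp only [pruneIndicator, ← hjoin]; rfl
  rw [pruneGF_none] at h
  linear_combination h

open PowerSeries in
theorem pruneGF_node (a b : BinTree) : pruneGF (some (.node a b)) =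
    pruneGF (some a) * pruneGF (some b) + 2 * X * pruneGF (some (.node a b)) := by
  have hjoin : ∀ x y : Option BinTree,
      (if BinTree.joinPruned x y = some (.node a b) then (1 : ℤ) else 0) =
        (if x = some a then 1 else 0) * (if y = some b then 1 else 0) +
        (if x = some (.node a b) then 1 else 0) * (if y = none then 1 else 0) +
        (if x = none then 1 else 0) * (if y = some (.node a b) then 1 else 0) := by
    rintro (_ | x) (_ | y) <;> simp [BinTree.joinPruned, ← ite_and, and_comm]
  have h : pruneGF (some (.node a b)) = pruneGF (some a) * pruneGF (some b) +
      pruneGF (some (.node a b)) * pruneGF none + pruneGF none * pruneGF (some (.node a b)) :=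
    treeGF_eq _ _ _ _ _ _ _ (by simp [pruneIndicator, BinTree.prune])
      fun l r => by simp only [pruneIndicator, ← hjoin]; rfl
  rw [pruneGF_none] at h
  linear_combination h

open PowerSeries in
theorem mk_choose_mul_two_pow (j : ℕ) :
    (1 - 2 * X) ^ (j + 1) * (PowerSeries.mk fun n => ((2 ^ (n - j) * n.choose j : ℕ) : ℤ)) =
      X ^ j := by
  have hC : (2 * X : ℤ⟦X⟧) = C 2 * X := by simp
  induction j with
  | zero =>
    ext n
    rw [zero_add, pow_one, sub_mul, one_mul, hC, mul_assoc, map_sub, coeff_C_mul]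
    rcases n with _ | n
    · simp
    · simp [coeff_succ_X_mul, coeff_one, pow_succ']
  | succ j ih =>
    rw [pow_succ' (X : ℤ⟦X⟧), ← ih, pow_succ, mul_assoc, mul_left_comm X]
    congr 1
    ext n
    rw [sub_mul, one_mul, hC, mul_assoc, map_sub, coeff_C_mul]
    rcases n with _ | n
    · simp
    · simp only [coeff_succ_X_mul, coeff_mk]
      rw [Nat.choose_succ_succ, Nat.add_sub_add_right]
      rcases lt_or_ge n (j + 1) with h | h
      · simp [Nat.choose_eq_zero_of_lt h]
      · obtain ⟨m, rfl⟩ := Nat.exists_eq_add_of_le h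
        rw [show j + 1 + m - j = m + 1 by omega, show j + 1 + m - (j + 1) = m by omega]
        push_cast
        ring

open PowerSeries in
theorem one_sub_two_X_pow_mul_pruneGF (σ : BinTree) :
    (1 - 2 * X) ^ (2 * σ.magnitude) * pruneGF (some σ) =
      (1 - 2 * X) * X ^ (2 * σ.magnitude) := by
  induction σ with
  | leaf =>
    simp only [BinTree.magnitude]
    linear_combination (1 - 2 * X) * pruneGF_leaf
  | node a b ha hb =>
    have h0 : (1 - 2 * X : ℤ⟦X⟧) ≠ 0 := fun h => by
      have := congrArg (coeff 0) h
      simp at this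
    refine mul_left_cancel₀ h0 ?_
    simp only [BinTree.magnitude, mul_add, pow_add]
    linear_combination (1 - 2 * X) ^ (2 * a.magnitude) * (1 - 2 * X) ^ (2 * b.magnitude) *
      pruneGF_node a b + (1 - 2 * X) ^ (2 * b.magnitude) * pruneGF (some b) * ha +
      (1 - 2 * X) * X ^ (2 * a.magnitude) * hb

open PowerSeries in
theorem card_prune_eq (N k : ℕ) (σ : BinTree) (hσ : σ.magnitude = k + 1) :
    ((treesOf (N + 2)).filter fun τ => τ.prune = some σ).card =
      2 ^ (N - 2 * k) * N.choose (2 * k) := by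
  have h0 : (1 - 2 * X : ℤ⟦X⟧) ≠ 0 := fun h => by
    have := congrArg (coeff 0) h
    simp at this
  have h := one_sub_two_X_pow_mul_pruneGF σ
  rw [hσ] at h
  have key : pruneGF (some σ) = X ^ 2 *
      (PowerSeries.mk fun n => ((2 ^ (n - 2 * k) * n.choose (2 * k) : ℕ) : ℤ)) := by
    refine mul_left_cancel₀ (pow_ne_zero (2 * (k + 1)) h0) ?_
    rw [h]
    linear_combination (-(1 - 2 * X) * X ^ 2) * mk_choose_mul_two_pow (2 * k)
  have := congrArg (coeff (N + 2)) key
  rw [add_comm N 2, coeff_X_pow_mul', if_pos (by omega), show 2 + N - 2 = N by omega] at this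
  simp only [pruneGF, treeGF, pruneIndicator, coeff_mk, Finset.sum_boole] at this
  rw [add_comm 2 N] at this
  exact_mod_cast this

/-- The tree obtained by pruning a uniform tree is again uniform given its magnitude. -/
theorem sum_treesOf_prune (N : ℕ) (F : Option BinTree → ℂ) :
    ∑ τ ∈ treesOf (N + 2), F τ.prune = ∑ k ∈ Finset.range (N + 1),
      ((2 ^ (N - 2 * k) * N.choose (2 * k) : ℕ) : ℂ) *
        ∑ σ ∈ treesOf (k + 1), F (some σ) := by
  have h : ∀ τ ∈ treesOf (N + 2), F τ.prune = ∑ k ∈ Finset.range (N + 1),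
      ∑ σ ∈ treesOf (k + 1), if τ.prune = some σ then F (some σ) else 0 := by
    intro τ hτ
    rw [mem_treesOf] at hτ
    rcases hp : τ.prune with _ | ρ
    · rw [BinTree.prune_eq_none_iff] at hp
      simp [hp, BinTree.magnitude] at hτ
    · have h1 := BinTree.magnitude_prune_lt hp
      have h2 := ρ.one_le_magnitude
      rw [Finset.sum_eq_single (ρ.magnitude - 1)]
      · simp [mem_treesOf, h2]
      · intro k _ hk
        refine Finset.sum_eq_zero fun σ hσ => if_neg ?_
        rintro ⟨⟩
        rw [mem_treesOf] at hσ
        omega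
      · intro hk
        simp only [Finset.mem_range] at hk
        omega
  rw [Finset.sum_congr rfl h, Finset.sum_comm]
  refine Finset.sum_congr rfl fun k _ => ?_
  rw [Finset.sum_comm, Finset.mul_sum]
  refine Finset.sum_congr rfl fun σ hσ => ?_
  rw [← card_prune_eq N k σ ((mem_treesOf _ _).1 hσ), ← Finset.sum_filter, Finset.sum_const,
    nsmul_eq_mul]

/-- The probability that a uniform binary tree of magnitude `N + 2` has `k + 1` branches of
order 2. -/
noncomputable def cherryProb (N k : ℕ) : ℝ :=
  2 ^ (N - 2 * k) * N.choose (2 * k) * catalan k / catalan (N + 1)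

theorem cherryProb_nonneg (N k : ℕ) : 0 ≤ cherryProb N k := by
  unfold cherryProb
  positivity

theorem catalan_pos (n : ℕ) : 0 < catalan n := by
  have h := succ_mul_catalan_eq_centralBinom n
  have := Nat.centralBinom_pos n
  exact Nat.pos_of_ne_zero fun h0 => by simp [h0] at h; omega

theorem sum_cherryProb (N : ℕ) : ∑ k ∈ Finset.range (N + 1), cherryProb N k = 1 := by
  have h := sum_treesOf_prune N fun _ => 1
  simp only [Finset.sum_const, nsmul_eq_mul, mul_one, card_treesOf_succ] at h
  simp only [cherryProb]
  rw [← Finset.sum_div, div_eq_one_iff_eq (by exact_mod_cast (catalan_pos (N + 1)).ne')]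
  exact_mod_cast h.symm

theorem add_two_mul_catalan_succ (k : ℕ) :
    (k + 2) * catalan (k + 1) = 2 * (2 * k + 1) * catalan k := by
  have h1 := succ_mul_catalan_eq_centralBinom (k + 1)
  have h2 := succ_mul_catalan_eq_centralBinom k
  have h3 := Nat.succ_mul_centralBinom_succ k
  refine Nat.eq_of_mul_eq_mul_left (Nat.succ_pos k) ?_
  rw [← h1, ← h2] at h3
  simp only [Nat.succ_eq_add_one]
  linarith

theorem cherryProb_succ (N k : ℕ) :
    4 * (k + 1) * (k + 2) * cherryProb N (k + 1) =
      (N - 2 * k) * (N - 2 * k - 1) * cherryProb N k := by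
  unfold cherryProb
  rw [← mul_div_assoc, ← mul_div_assoc]
  congr 1
  rcases lt_or_ge N (2 * k + 2) with h | h
  · rw [Nat.choose_eq_zero_of_lt (show N < 2 * (k + 1) by omega)]
    rcases lt_or_ge N (2 * k) with h1 | h1
    · simp [Nat.choose_eq_zero_of_lt h1]
    · obtain rfl | rfl : N = 2 * k ∨ N = 2 * k + 1 := by omega
      · simp
      · simp
  · obtain ⟨j, rfl⟩ := Nat.exists_eq_add_of_le h
    have h1 := Nat.choose_succ_right_eq (2 * k + 2 + j) (2 * k)
    have h2 := Nat.choose_succ_right_eq (2 * k + 2 + j) (2 * k + 1)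
    rw [show 2 * k + 2 + j - 2 * k = j + 2 by omega] at h1
    rw [show 2 * k + 2 + j - (2 * k + 1) = j + 1 by omega] at h2
    have h3 := add_two_mul_catalan_succ k
    rw [show 2 * k + 2 + j - 2 * k = j + 2 by omega,
      show 2 * k + 2 + j - 2 * (k + 1) = j by omega, show 2 * (k + 1) = 2 * k + 1 + 1 by ring]
    have h1' := congrArg (Nat.cast (R := ℝ)) h1
    have h2' := congrArg (Nat.cast (R := ℝ)) h2
    have h3' := congrArg (Nat.cast (R := ℝ)) h3
    push_cast at h1' h2' h3' ⊢
    generalize ((2 * k + 2 + j).choose (2 * k) : ℝ) = a at *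
    generalize ((2 * k + 2 + j).choose (2 * k + 1) : ℝ) = b at *
    generalize ((2 * k + 2 + j).choose (2 * k + 1 + 1) : ℝ) = c at *
    rw [pow_add]
    linear_combination 4 * (k + 1 : ℝ) * 2 ^ j * c * h3' +
      4 * 2 ^ j * (catalan k : ℝ) * (2 * k + 1) * h2' + 4 * 2 ^ j * (catalan k : ℝ) * (j + 1) * h1'

/-- A discrete Stein identity for the number of branches of order 2. -/
theorem sum_cherryProb_stein {E : Type*} [AddCommGroup E] [Module ℝ E] (N : ℕ) (g : ℕ → E) :
    ∑ k ∈ Finset.range (N + 1), cherryProb N k •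
      (((N - 2 * k : ℝ) * (N - 2 * k - 1)) • g (k + 1) - (4 * k * (k + 1) : ℝ) • g k) = 0 := by
  simp only [smul_sub, Finset.sum_sub_distrib]
  rw [sub_eq_zero]
  have h1 : ∑ k ∈ Finset.range (N + 1), cherryProb N k • ((4 * k * (k + 1) : ℝ) • g k) =
      ∑ k ∈ Finset.range (N + 2), cherryProb N k • ((4 * k * (k + 1) : ℝ) • g k) := by
    rw [Finset.sum_range_succ _ (N + 1)]
    simp [cherryProb, Nat.choose_eq_zero_of_lt (show N < 2 * (N + 1) by omega)]
  rw [h1, Finset.sum_range_succ' _ (N + 1)]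
  simp only [Nat.cast_zero, mul_zero, zero_mul, zero_smul, smul_zero, add_zero]
  refine Finset.sum_congr rfl fun k _ => ?_
  rw [smul_smul, smul_smul]
  congr 1
  have := cherryProb_succ N k
  push_cast
  linarith

theorem sum_cherryProb_mul_sq_le (N : ℕ) (hN : 3 ≤ N) :
    ∑ k ∈ Finset.range (N + 1), cherryProb N k * ((k + 1 : ℝ) - (N + 2) / 4) ^ 2 ≤
      (N + 2 : ℝ) := by
  have h0 := sum_cherryProb N
  have h1 := sum_cherryProb_stein N fun _ => (1 : ℝ)
  have h2 := sum_cherryProb_stein N fun k => ((k + 1 : ℝ) - (N + 2) / 4)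
  set M1 := ∑ k ∈ Finset.range (N + 1), cherryProb N k * ((k + 1 : ℝ) - (N + 2) / 4) with hM1
  set M2 := ∑ k ∈ Finset.range (N + 1), cherryProb N k * ((k + 1 : ℝ) - (N + 2) / 4) ^ 2 with hM2
  have e1 : (4 * (N + 2) - 6 : ℝ) * M1 = (N + 2) / 2 := by
    have : (N + 2 : ℝ) / 2 * (∑ k ∈ Finset.range (N + 1), cherryProb N k) -
        (4 * (N + 2) - 6 : ℝ) * M1 = 0 := by
      rw [← h1, hM1, Finset.mul_sum, Finset.mul_sum, ← Finset.sum_sub_distrib]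
      refine Finset.sum_congr rfl fun k _ => ?_
      simp only [smul_eq_mul]
      ring
    rw [h0] at this
    linarith
  have e2 : (4 * (N + 2) - 10 : ℝ) * M2 =
      ((N + 2) ^ 2 / 4 - (N + 2) / 2) + (2 - 3 * (N + 2) / 2) * M1 := by
    have : ((N + 2) ^ 2 / 4 - (N + 2) / 2 : ℝ) * (∑ k ∈ Finset.range (N + 1), cherryProb N k) +
        (2 - 3 * (N + 2) / 2) * M1 -
        (4 * (N + 2) - 10 : ℝ) * M2 = 0 := by
      rw [← h2, hM1, hM2, Finset.mul_sum, Finset.mul_sum, Finset.mul_sum,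
        ← Finset.sum_add_distrib, ← Finset.sum_sub_distrib]
      refine Finset.sum_congr rfl fun k _ => ?_
      simp only [smul_eq_mul]
      push_cast
      ring
    rw [h0] at this
    linarith
  have hN' : (3 : ℝ) ≤ N := by exact_mod_cast hN
  have hM1' : 0 ≤ M1 := by
    by_contra! h
    nlinarith
  have : (4 * (N + 2) - 10 : ℝ) * M2 ≤ (4 * (N + 2) - 10) * (N + 2) := by
    rw [e2]
    nlinarith
  exact le_of_mul_le_mul_left this (by linarith)

/-- The standardized value of the number `k + 1` of branches of order 2. -/
noncomputable def cherryDev (N k : ℕ) : ℝ :=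
  ((k + 1 : ℝ) - (N + 2) / 4) / √(N + 2)

/-- The characteristic function of the standardized number of branches of order 2. -/
noncomputable def cherryChar (N : ℕ) (s : ℝ) : ℂ :=
  ∑ k ∈ Finset.range (N + 1), (cherryProb N k : ℂ) * Complex.exp (Complex.I * (s * cherryDev N k))

theorem sum_cherryProb_mul_cherryDev_sq_le (N : ℕ) (hN : 3 ≤ N) :
    ∑ k ∈ Finset.range (N + 1), cherryProb N k * cherryDev N k ^ 2 ≤ 1 := by
  have h := sum_cherryProb_mul_sq_le N hN
  have h0 : (0 : ℝ) < N + 2 := by positivity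
  simp only [cherryDev, div_pow, Real.sq_sqrt h0.le, ← mul_div_assoc]
  rw [← Finset.sum_div]
  exact div_le_one_of_le₀ h h0.le

theorem hasDerivAt_cherryChar (N : ℕ) (s : ℝ) :
    HasDerivAt (cherryChar N) (∑ k ∈ Finset.range (N + 1), (cherryProb N k : ℂ) *
      (Complex.exp (Complex.I * (s * cherryDev N k)) * (Complex.I * cherryDev N k))) s := by
  refine HasDerivAt.fun_sum fun k _ => HasDerivAt.const_mul _ ?_
  have h : HasDerivAt (fun s : ℝ => Complex.I * ((s : ℂ) * cherryDev N k))
      (Complex.I * (1 * cherryDev N k)) s :=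
    ((hasDerivAt_id s).ofReal_comp.mul_const _).const_mul _
  simpa using h.cexp

theorem norm_exp_I_mul_ofReal (x : ℝ) : ‖Complex.exp (Complex.I * x)‖ = 1 := by
  rw [mul_comm, Complex.norm_exp_ofReal_mul_I]

theorem cherryChar_stein (N : ℕ) (s : ℝ) :
    (∑ k ∈ Finset.range (N + 1), (cherryProb N k : ℂ) *
      (Complex.exp (Complex.I * (s * cherryDev N k)) * (Complex.I * cherryDev N k))) +
      s / 16 * cherryChar N s = Complex.I / 4 * ∑ k ∈ Finset.range (N + 1), (cherryProb N k : ℂ) *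
        (Complex.exp (Complex.I * (s * cherryDev N k)) *
          (√(N + 2) / 4 * (Complex.exp (Complex.I * (s / √(N + 2) : ℝ)) - 1 -
              Complex.I * (s / √(N + 2) : ℝ)) +
            (-2 * cherryDev N k + 4 * cherryDev N k ^ 2 / √(N + 2) - 1 / (2 * √(N + 2)) +
              2 * cherryDev N k / √(N + 2) ^ 2) *
                (Complex.exp (Complex.I * (s / √(N + 2) : ℝ)) - 1) +
            (1 / (2 * √(N + 2)) + 6 * cherryDev N k / √(N + 2) ^ 2))) := by
  set ρ : ℝ := √(N + 2) with hρ
  have hρ0 : 0 < ρ := by rw [hρ]; positivity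
  have hρ2 : ρ ^ 2 = N + 2 := Real.sq_sqrt (by positivity)
  have hρC : (ρ : ℂ) ≠ 0 := by exact_mod_cast hρ0.ne'
  set u : ℂ := Complex.exp (Complex.I * (s / ρ : ℝ)) with hu
  have hS := sum_cherryProb_stein N fun k => Complex.exp (Complex.I * (s * cherryDev N k))
  have hstep : ∀ k, Complex.exp (Complex.I * (s * cherryDev N (k + 1))) =
      Complex.exp (Complex.I * (s * cherryDev N k)) * u := fun k => by
    rw [hu, ← Complex.exp_add]
    congr 1
    simp only [cherryDev, ← hρ]
    push_cast
    field_simp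
    ring
  simp only [hstep] at hS
  have hS' : Complex.I / 4 * (∑ k ∈ Finset.range (N + 1), cherryProb N k •
      (((N - 2 * k : ℝ) * (N - 2 * k - 1)) • (Complex.exp (Complex.I * (s * cherryDev N k)) * u) -
        (4 * k * (k + 1) : ℝ) • Complex.exp (Complex.I * (s * cherryDev N k)))) / ρ ^ 3 = 0 := by
    rw [hS]
    simp
  rw [← sub_eq_zero, ← neg_eq_zero, ← hS', cherryChar, Finset.mul_sum, Finset.mul_sum,
    Finset.mul_sum, ← Finset.sum_add_distrib, ← Finset.sum_sub_distrib, ← Finset.sum_neg_distrib,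
    Finset.sum_div]
  refine Finset.sum_congr rfl fun k _ => ?_
  simp only [Complex.real_smul]
  generalize Complex.exp (Complex.I * (s * cherryDev N k)) = e
  have hk : (k : ℝ) = ρ * cherryDev N k + ρ ^ 2 / 4 - 1 := by
    simp only [cherryDev, ← hρ]
    rw [mul_div_cancel₀ _ hρ0.ne', hρ2]
    ring
  rw [hk, show (N : ℝ) = ρ ^ 2 - 2 by linarith]
  generalize cherryDev N k = x
  push_cast
  field_simp
  ring_nf
  simp only [Complex.I_sq]
  ring

theorem norm_cherryChar_ode_le (N : ℕ) (hN : 3 ≤ N) (s T : ℝ) (hs : |s| ≤ T)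
    (hT : T ≤ √(N + 2)) :
    ‖(∑ k ∈ Finset.range (N + 1), (cherryProb N k : ℂ) *
      (Complex.exp (Complex.I * (s * cherryDev N k)) * (Complex.I * cherryDev N k))) +
      s / 16 * cherryChar N s‖ ≤ (T ^ 2 + 9 * T + 7) / √(N + 2) := by
  rw [cherryChar_stein]
  set ρ : ℝ := √(N + 2) with hρ
  have hρ1 : 1 ≤ ρ := by
    rw [hρ, Real.one_le_sqrt]
    have : (0 : ℝ) ≤ N := by positivity
    linarith
  have hρ0 : 0 < ρ := by linarith
  have hT0 : 0 ≤ T := (abs_nonneg s).trans hs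
  set K : ℝ := (T ^ 2 + 9 * T + 7) / ρ with hK
  have hK0 : 0 ≤ K := by positivity
  have hsρ : |s / ρ| ≤ T / ρ := by
    rw [abs_div, abs_of_pos hρ0]
    gcongr
  have hu1 : ‖Complex.exp (Complex.I * (s / ρ : ℝ)) - 1‖ ≤ T / ρ :=
    Real.norm_exp_I_mul_ofReal_sub_one_le.trans hsρ
  have hu2 : ‖Complex.exp (Complex.I * (s / ρ : ℝ)) - 1 - Complex.I * (s / ρ : ℝ)‖ ≤
      (T / ρ) ^ 2 := by
    have hn : ‖Complex.I * ((s / ρ : ℝ) : ℂ)‖ = |s / ρ| := by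
      rw [norm_mul, Complex.norm_I, one_mul, Complex.norm_real, Real.norm_eq_abs]
    refine (Complex.norm_exp_sub_one_sub_id_le ?_).trans ?_
    · rw [hn]
      exact hsρ.trans (div_le_one_of_le₀ hT hρ0.le)
    · rw [hn]
      gcongr
  generalize Complex.exp (Complex.I * (s / ρ : ℝ)) = u at *
  have hterm : ∀ x : ℝ, ‖(ρ / 4 * (u - 1 - Complex.I * (s / ρ : ℝ)) +
      (-2 * x + 4 * x ^ 2 / ρ - 1 / (2 * ρ) + 2 * x / ρ ^ 2) * (u - 1) +
        (1 / (2 * ρ) + 6 * x / ρ ^ 2) : ℂ)‖ ≤ K * (1 + x ^ 2) := by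
    intro x
    have hx : |x| ≤ 1 + x ^ 2 := by
      rw [← sq_abs]
      nlinarith [sq_nonneg (|x| - 1)]
    have h1 : ‖(ρ / 4 * (u - 1 - Complex.I * (s / ρ : ℝ)) : ℂ)‖ ≤ ρ / 4 * (T / ρ) ^ 2 := by
      rw [norm_mul]
      gcongr
      simp [abs_of_pos hρ0]
    have h2 : ‖(-2 * x + 4 * x ^ 2 / ρ - 1 / (2 * ρ) + 2 * x / ρ ^ 2 : ℂ)‖ ≤
        9 * (1 + x ^ 2) := by
      have : (-2 * x + 4 * x ^ 2 / ρ - 1 / (2 * ρ) + 2 * x / ρ ^ 2 : ℂ) =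
          ((-2 * x + 4 * x ^ 2 / ρ - 1 / (2 * ρ) + 2 * x / ρ ^ 2 : ℝ) : ℂ) := by push_cast; rfl
      rw [this, Complex.norm_real, Real.norm_eq_abs]
      have a1 : 4 * x ^ 2 / ρ ≤ 4 * x ^ 2 := div_le_self (by positivity) hρ1
      have a2 : 0 ≤ 4 * x ^ 2 / ρ := by positivity
      have a3 : 1 / (2 * ρ) ≤ 1 := by
        rw [div_le_one (by positivity)]
        linarith
      have a4 : 0 ≤ 1 / (2 * ρ) := by positivity
      have a5 : |2 * x / ρ ^ 2| ≤ 2 * |x| := by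
        rw [abs_div, abs_mul, abs_two, abs_of_pos (by positivity : 0 < ρ ^ 2)]
        exact div_le_self (by positivity) (one_le_pow₀ hρ1)
      have a6 := abs_le.1 a5
      have a7 := abs_le.1 (le_refl |x|)
      rw [abs_le]
      constructor <;> nlinarith
    have h3 : ‖(1 / (2 * ρ) + 6 * x / ρ ^ 2 : ℂ)‖ ≤ 7 * (1 + x ^ 2) / ρ := by
      have : (1 / (2 * ρ) + 6 * x / ρ ^ 2 : ℂ) = (((1 / 2 + 6 * x / ρ) / ρ : ℝ) : ℂ) := by
        have hρC : (ρ : ℂ) ≠ 0 := by exact_mod_cast hρ0.ne'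
        push_cast
        field_simp
      rw [this, Complex.norm_real, Real.norm_eq_abs, abs_div, abs_of_pos hρ0]
      have a5 : |6 * x / ρ| ≤ 6 * |x| := by
        rw [abs_div, abs_mul, abs_of_pos hρ0, abs_of_pos (by norm_num : (0 : ℝ) < 6)]
        exact div_le_self (by positivity) hρ1
      have a6 := abs_le.1 a5
      gcongr
      rw [abs_le]
      constructor <;> nlinarith
    refine (norm_add₃_le).trans ?_
    rw [norm_mul _ (u - 1)]
    have h4 := mul_le_mul h2 hu1 (norm_nonneg _) (by positivity)
    refine (add_le_add_three h1 h4 h3).trans ?_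
    have h5 : ρ / 4 * (T / ρ) ^ 2 + 9 * (1 + x ^ 2) * (T / ρ) + 7 * (1 + x ^ 2) / ρ =
        (T ^ 2 / 4 + 9 * T * (1 + x ^ 2) + 7 * (1 + x ^ 2)) / ρ := by
      field_simp
    rw [h5, hK, div_mul_eq_mul_div]
    gcongr
    nlinarith [sq_nonneg T, mul_nonneg (sq_nonneg T) (sq_nonneg x)]
  have hsum : ‖∑ k ∈ Finset.range (N + 1), (cherryProb N k : ℂ) *
      (Complex.exp (Complex.I * (s * cherryDev N k)) *
        (ρ / 4 * (u - 1 - Complex.I * (s / ρ : ℝ)) +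
          (-2 * cherryDev N k + 4 * cherryDev N k ^ 2 / ρ - 1 / (2 * ρ) +
            2 * cherryDev N k / ρ ^ 2) * (u - 1) +
          (1 / (2 * ρ) + 6 * cherryDev N k / ρ ^ 2)))‖ ≤ K * 2 := by
    refine (norm_sum_le _ _).trans ?_
    calc _ ≤ ∑ k ∈ Finset.range (N + 1),
          K * (cherryProb N k + cherryProb N k * cherryDev N k ^ 2) := by
          refine Finset.sum_le_sum fun k _ => ?_
          rw [norm_mul, norm_mul, ← Complex.ofReal_mul, norm_exp_I_mul_ofReal, one_mul,
            Complex.norm_real, Real.norm_eq_abs, abs_of_nonneg (cherryProb_nonneg N k)]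
          have := mul_le_mul_of_nonneg_left (hterm (cherryDev N k)) (cherryProb_nonneg N k)
          linarith
      _ ≤ K * 2 := by
          rw [← Finset.mul_sum, Finset.sum_add_distrib, sum_cherryProb]
          have := sum_cherryProb_mul_cherryDev_sq_le N hN
          gcongr
          linarith
  rw [norm_mul]
  have : ‖Complex.I / 4‖ = 1 / 4 := by simp
  rw [this]
  linarith

theorem norm_cherryChar_sub_le (N : ℕ) (hN : 3 ≤ N) (s T : ℝ) (hs : |s| ≤ T)
    (hT : T ≤ √(N + 2)) :
    ‖cherryChar N s - Real.exp (-s ^ 2 / 32)‖ ≤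
      Real.exp (T ^ 2 / 32) * (T ^ 2 + 9 * T + 7) * T / √(N + 2) := by
  have hT0 : 0 ≤ T := (abs_nonneg s).trans hs
  have hderiv : ∀ x : ℝ, HasDerivAt (fun x : ℝ => cherryChar N x * (Real.exp (x ^ 2 / 32) : ℝ))
      (((∑ k ∈ Finset.range (N + 1), (cherryProb N k : ℂ) *
        (Complex.exp (Complex.I * (x * cherryDev N k)) * (Complex.I * cherryDev N k))) +
        x / 16 * cherryChar N x) * (Real.exp (x ^ 2 / 32) : ℝ)) x := by
    intro x
    have h1 : HasDerivAt (fun x : ℝ => Real.exp (x ^ 2 / 32))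
        (Real.exp (x ^ 2 / 32) * (x / 16)) x := by
      have := ((hasDerivAt_pow 2 x).div_const 32).exp
      convert this using 1
      push_cast
      ring
    refine ((hasDerivAt_cherryChar N x).fun_mul h1.ofReal_comp).congr_deriv ?_
    push_cast
    ring
  have hbound := Convex.norm_image_sub_le_of_norm_hasDerivWithin_le
    (C := (T ^ 2 + 9 * T + 7) / √(N + 2) * Real.exp (T ^ 2 / 32)) (s := Set.Icc (-T) T)
    (fun x _ => (hderiv x).hasDerivWithinAt) (fun x hx => by
      rw [norm_mul, Complex.norm_real, Real.norm_eq_abs, Real.abs_exp]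
      have hxT : |x| ≤ T := abs_le.2 hx
      have hx2 : x ^ 2 ≤ T ^ 2 := sq_le_sq' hx.1 hx.2
      gcongr
      exact norm_cherryChar_ode_le N hN x T hxT hT)
    (convex_Icc _ _) (show (0 : ℝ) ∈ Set.Icc (-T) T from ⟨by linarith, hT0⟩)
    (show s ∈ Set.Icc (-T) T from abs_le.1 hs)
  have h0 : cherryChar N 0 = 1 := by
    have := sum_cherryProb N
    simp only [cherryChar, Complex.ofReal_zero, zero_mul, mul_zero, Complex.exp_zero, mul_one]
    exact_mod_cast this
  have hE : cherryChar N s - Real.exp (-s ^ 2 / 32) =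
      (cherryChar N s * (Real.exp (s ^ 2 / 32) : ℝ) - 1) * (Real.exp (-s ^ 2 / 32) : ℝ) := by
    rw [sub_mul, mul_assoc, ← Complex.ofReal_mul, ← Real.exp_add,
      show s ^ 2 / 32 + -s ^ 2 / 32 = 0 by ring]
    simp
  rw [hE, norm_mul, Complex.norm_real, Real.norm_eq_abs, Real.abs_exp]
  simp only [h0, sub_zero, Real.norm_eq_abs] at hbound
  rw [Complex.ofReal_exp] at hbound
  norm_num at hbound
  have h1 : Real.exp (-s ^ 2 / 32) ≤ 1 := Real.exp_le_one_iff.2 (by nlinarith [sq_nonneg s])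
  push_cast
  calc _ ≤ ((T ^ 2 + 9 * T + 7) / √(N + 2) * Real.exp (T ^ 2 / 32) * |s|) * 1 := by
        gcongr
    _ ≤ ((T ^ 2 + 9 * T + 7) / √(N + 2) * Real.exp (T ^ 2 / 32) * T) * 1 := by gcongr
    _ = _ := by ring

/-- The characteristic function of the standardized number of branches of order `r + 1` in a
uniform binary tree of magnitude `n`. -/
noncomputable def branchChar (r n : ℕ) (t : ℝ) : ℂ :=
  (∑ τ ∈ treesOf n, Complex.exp (Complex.I *
    (t * (√n * ((BinTree.branches (r + 1) τ : ℝ) / n - 1 / 4 ^ r)) : ℝ))) / (treesOf n).card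

theorem norm_branchChar_le (r n : ℕ) (t : ℝ) : ‖branchChar r n t‖ ≤ 1 := by
  rw [branchChar, norm_div, Complex.norm_natCast]
  refine div_le_one_of_le₀ ((norm_sum_le _ _).trans ?_) (Nat.cast_nonneg _)
  simp only [norm_exp_I_mul_ofReal]
  simp

theorem branchChar_succ (r N : ℕ) (t : ℝ) :
    branchChar (r + 1) (N + 2) t = ∑ k ∈ Finset.range (N + 1), (cherryProb N k : ℂ) *
      (Complex.exp (Complex.I * ((t / 4 ^ r : ℝ) * cherryDev N k)) *
        branchChar r (k + 1) (t * √((k + 1) / (N + 2)))) := by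
  have h := sum_treesOf_prune N fun o => Complex.exp (Complex.I *
    (t * (√(N + 2 : ℕ) * (((o.elim 0 (BinTree.branches (r + 1)) : ℕ) : ℝ) / (N + 2 : ℕ) -
      1 / 4 ^ (r + 1))) : ℝ))
  simp only [branchChar, BinTree.branches_eq_prune, h, card_treesOf_succ]
  rw [Finset.sum_div]
  refine Finset.sum_congr rfl fun k _ => ?_
  simp only [Option.elim_some]
  have hk : (catalan k : ℂ) ≠ 0 := by exact_mod_cast (catalan_pos k).ne'
  have hN : (catalan (N + 1) : ℂ) ≠ 0 := by exact_mod_cast (catalan_pos (N + 1)).ne'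
  have hσ : ∀ σ : BinTree, Complex.exp (Complex.I *
      (t * (√(N + 2 : ℕ) * (((BinTree.branches (r + 1) σ : ℕ) : ℝ) / (N + 2 : ℕ) -
        1 / 4 ^ (r + 1))) : ℝ)) = Complex.exp (Complex.I * ((t / 4 ^ r : ℝ) * cherryDev N k)) *
      Complex.exp (Complex.I * (t * √((k + 1) / (N + 2)) *
        (√(k + 1 : ℕ) * ((BinTree.branches (r + 1) σ : ℝ) / (k + 1 : ℕ) - 1 / 4 ^ r)) : ℝ)) := by
    intro σ
    rw [← Complex.exp_add, ← mul_add, ← Complex.ofReal_mul, ← Complex.ofReal_add]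
    congr 3
    rw [cherryDev, Real.sqrt_div (by positivity)]
    push_cast
    have h1 : √((N : ℝ) + 2) ^ 2 = N + 2 := Real.sq_sqrt (by positivity)
    have h2 : √((k : ℝ) + 1) ^ 2 = k + 1 := Real.sq_sqrt (by positivity)
    have h3 : 0 < √((N : ℝ) + 2) := by positivity
    have h4 : 0 < √((k : ℝ) + 1) := by positivity
    rw [← h1, ← h2, Real.sqrt_sq h3.le, Real.sqrt_sq h4.le]
    field_simp
    ring
  simp only [hσ, ← Finset.mul_sum, cherryProb]
  generalize Finset.sum (M := ℂ) (treesOf (k + 1)) _ = S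
  generalize Complex.exp _ = e
  push_cast
  field_simp

theorem norm_sub_cherryChar_mul_le (r N : ℕ) (hN : 3 ≤ N) (t δ ε : ℝ) (hδ : 0 < δ) (hε : 0 ≤ ε)
    (g : ℂ) (hg : ‖g‖ ≤ 1)
    (h : ∀ k : ℕ, |(k + 1 : ℝ) / (N + 2) - 1 / 4| < δ →
      ‖branchChar r (k + 1) (t * √((k + 1) / (N + 2))) - g‖ ≤ ε) :
    ‖branchChar (r + 1) (N + 2) t - cherryChar N (t / 4 ^ r) * g‖ ≤
      ε + 2 / δ ^ 2 / (N + 2) := by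
  rw [branchChar_succ, cherryChar, Finset.sum_mul, ← Finset.sum_sub_distrib]
  refine (norm_sum_le _ _).trans ?_
  calc _ ≤ ∑ k ∈ Finset.range (N + 1), (ε * cherryProb N k +
        2 / δ ^ 2 / (N + 2) * (cherryProb N k * cherryDev N k ^ 2)) := by
        refine Finset.sum_le_sum fun k _ => ?_
        have hp := cherryProb_nonneg N k
        rw [mul_assoc, ← mul_sub, ← mul_sub, norm_mul, norm_mul, ← Complex.ofReal_mul,
          norm_exp_I_mul_ofReal, one_mul, Complex.norm_real, Real.norm_eq_abs, abs_of_nonneg hp]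
        have h0 : (0 : ℝ) < N + 2 := by positivity
        have hdev : cherryDev N k ^ 2 / (N + 2) = ((k + 1 : ℝ) / (N + 2) - 1 / 4) ^ 2 := by
          rw [cherryDev, div_pow, Real.sq_sqrt h0.le]
          field_simp
        have key : ‖branchChar r (k + 1) (t * √((k + 1) / (N + 2))) - g‖ ≤
            ε + 2 / δ ^ 2 * (cherryDev N k ^ 2 / (N + 2)) := by
          rcases lt_or_ge |(k + 1 : ℝ) / (N + 2) - 1 / 4| δ with hk | hk
          · have := h k hk
            have : 0 ≤ 2 / δ ^ 2 * (cherryDev N k ^ 2 / (N + 2)) := by positivity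
            linarith
          · have h1 : ‖branchChar r (k + 1) (t * √((k + 1) / (N + 2))) - g‖ ≤ 1 + 1 :=
              (norm_sub_le _ _).trans (add_le_add (norm_branchChar_le _ _ _) hg)
            have h2 : δ ^ 2 ≤ ((k + 1 : ℝ) / (N + 2) - 1 / 4) ^ 2 := by
              rw [← sq_abs (_ - _)]
              gcongr
            have h3 : 2 ≤ 2 / δ ^ 2 * ((k + 1 : ℝ) / (N + 2) - 1 / 4) ^ 2 := by
              rw [div_mul_eq_mul_div, le_div_iff₀ (by positivity)]
              linarith
            rw [hdev]
            linarith
        calc _ ≤ cherryProb N k * (ε + 2 / δ ^ 2 * (cherryDev N k ^ 2 / (N + 2))) := by gcongr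
          _ = _ := by ring
    _ ≤ ε * 1 + 2 / δ ^ 2 / (N + 2) * 1 := by
        rw [Finset.sum_add_distrib, ← Finset.mul_sum, ← Finset.mul_sum, sum_cherryProb]
        gcongr
        exact sum_cherryProb_mul_cherryDev_sq_le N hN
    _ = _ := by ring

theorem tendsto_const_div_sqrt_add_two (c : ℝ) :
    Tendsto (fun N : ℕ => c / √((N : ℝ) + 2)) atTop (𝓝 0) :=
  tendsto_const_nhds.div_atTop
    (Real.tendsto_sqrt_atTop.comp (tendsto_atTop_add_const_right _ _ tendsto_natCast_atTop_atTop))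

theorem tendsto_cherryChar (s : ℝ) :
    Tendsto (fun p : ℕ × ℝ => cherryChar p.1 p.2) (atTop ×ˢ 𝓝 s)
      (𝓝 (Real.exp (-s ^ 2 / 32) : ℝ)) := by
  have h1 : Tendsto (fun p : ℕ × ℝ => ((Real.exp (-p.2 ^ 2 / 32) : ℝ) : ℂ)) (atTop ×ˢ 𝓝 s)
      (𝓝 (Real.exp (-s ^ 2 / 32) : ℝ)) := by
    have : Continuous fun x : ℝ => ((Real.exp (-x ^ 2 / 32) : ℝ) : ℂ) := by fun_prop
    exact (this.tendsto s).comp tendsto_snd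
  have h2 : Tendsto (fun p : ℕ × ℝ => cherryChar p.1 p.2 - (Real.exp (-p.2 ^ 2 / 32) : ℝ))
      (atTop ×ˢ 𝓝 s) (𝓝 0) := by
    set T : ℝ := |s| + 1 with hT
    have hs : ∀ᶠ x in 𝓝 s, |x| ≤ T :=
      (continuous_abs.tendsto s).eventually (eventually_le_nhds (by linarith))
    have hn : ∀ᶠ N : ℕ in atTop, 3 ≤ N ∧ T ≤ √((N : ℝ) + 2) :=
      (eventually_ge_atTop 3).and ((Real.tendsto_sqrt_atTop.comp
        (tendsto_atTop_add_const_right _ _ tendsto_natCast_atTop_atTop)).eventually_ge_atTop T)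
    refine squeeze_zero_norm' ?_ ((tendsto_const_div_sqrt_add_two
      (Real.exp (T ^ 2 / 32) * (T ^ 2 + 9 * T + 7) * T)).comp tendsto_fst)
    filter_upwards [hn.prod_mk hs] with p hp
    exact norm_cherryChar_sub_le p.1 hp.1.1 p.2 T hp.2 hp.1.2
  simpa using h2.add h1

theorem tendsto_branchChar_sub (r : ℕ) (t : ℝ) (g : ℂ)
    (h : Tendsto (fun p : ℕ × ℝ => branchChar r p.1 p.2) (atTop ×ˢ 𝓝 (t / 2)) (𝓝 g)) :
    Tendsto (fun p : ℕ × ℝ => branchChar (r + 1) (p.1 + 2) p.2 - cherryChar p.1 (p.2 / 4 ^ r) * g)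
      (atTop ×ˢ 𝓝 t) (𝓝 0) := by
  have hg : ‖g‖ ≤ 1 := le_of_tendsto h.norm (Eventually.of_forall fun p => norm_branchChar_le _ _ _)
  rw [Metric.tendsto_nhds]
  intro ε hε
  have h1 := (Metric.tendsto_nhds.1 h) (ε / 2) (half_pos hε)
  obtain ⟨pa, ha, pb, hb, hab⟩ := eventually_prod_iff.1 h1
  obtain ⟨M, hM⟩ := eventually_atTop.1 ha
  have hc : Tendsto (fun q : ℝ × ℝ => q.1 * √q.2) (𝓝 t ×ˢ 𝓝 (1 / 4)) (𝓝 (t / 2)) := by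
    have : Continuous fun q : ℝ × ℝ => q.1 * √q.2 := by fun_prop
    have h2 := this.tendsto (t, 1 / 4)
    rw [nhds_prod_eq] at h2
    convert h2 using 2
    rw [show (1 / 4 : ℝ) = (1 / 2) ^ 2 by norm_num, Real.sqrt_sq (by norm_num)]
    ring
  obtain ⟨pc, hpc, pd, hpd, hcd⟩ := eventually_prod_iff.1 (hc.eventually hb)
  obtain ⟨δ, hδ, hδd⟩ := Metric.eventually_nhds_iff.1 hpd
  set δ' := min δ (1 / 8) with hδ'
  have hδ'0 : 0 < δ' := lt_min hδ (by norm_num)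
  have hlim : ∀ᶠ N : ℕ in atTop, 2 / δ' ^ 2 / ((N : ℝ) + 2) < ε / 2 := by
    have : Tendsto (fun N : ℕ => 2 / δ' ^ 2 / ((N : ℝ) + 2)) atTop (𝓝 0) :=
      tendsto_const_nhds.div_atTop
        (tendsto_atTop_add_const_right _ _ tendsto_natCast_atTop_atTop)
    exact this.eventually (gt_mem_nhds (half_pos hε))
  have hn := hlim.and ((eventually_ge_atTop 3).and (eventually_ge_atTop (8 * M)))
  filter_upwards [hn.prod_mk hpc] with p hp
  obtain ⟨⟨hp1, hp2, hp3⟩, hp4⟩ := hp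
  rw [dist_zero_right]
  refine (norm_sub_cherryChar_mul_le r p.1 hp2 p.2 δ' (ε / 2) hδ'0 (half_pos hε).le g hg
    fun k hk => ?_).trans_lt (by linarith)
  rw [← dist_eq_norm]
  refine (hab (x := k + 1) (hM _ ?_) (y := p.2 * √((k + 1) / (p.1 + 2)))
    (hcd (x := p.2) hp4 (y := (k + 1) / (p.1 + 2)) (hδd ?_))).le
  · have h2 := (abs_lt.1 (hk.trans_le (min_le_right _ _))).1
    have h0 : (0 : ℝ) < p.1 + 2 := by positivity
    have h3 : 1 / 8 < (k + 1 : ℝ) / (p.1 + 2) := by linarith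
    rw [lt_div_iff₀ h0] at h3
    have h4 : (8 * M : ℝ) ≤ p.1 := by exact_mod_cast hp3
    have h5 : (M : ℝ) ≤ ((k + 1 : ℕ) : ℝ) := by
      push_cast
      linarith
    exact_mod_cast h5
  · rw [Real.dist_eq]
    exact hk.trans_le (min_le_left _ _)

theorem tendsto_branchChar (r : ℕ) (t : ℝ) :
    Tendsto (fun p : ℕ × ℝ => branchChar r p.1 p.2) (atTop ×ˢ 𝓝 t)
      (𝓝 (Real.exp (-((4 ^ r - 1) / (3 * 16 ^ r)) * t ^ 2 / 2) : ℝ)) := by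
  induction r generalizing t with
  | zero =>
    refine tendsto_const_nhds.congr' ?_
    have h : ∀ᶠ n : ℕ in atTop, 1 ≤ n := eventually_ge_atTop 1
    filter_upwards [h.prod_inl (𝓝 t)] with p hp
    obtain ⟨m, hm⟩ := Nat.exists_eq_add_of_le' hp
    have h0 : ((m + 1 : ℕ) : ℝ) ≠ 0 := by positivity
    have hc : ((treesOf (m + 1)).card : ℂ) ≠ 0 := by
      rw [card_treesOf_succ]
      exact_mod_cast (catalan_pos m).ne'
    rw [hm, branchChar, Finset.sum_congr rfl (g := fun _ => 1)]
    · simp [hc]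
    · intro τ hτ
      rw [zero_add, BinTree.branches_one, (mem_treesOf _ _).1 hτ, div_self h0]
      simp
  | succ r ih =>
    have h1 := tendsto_branchChar_sub r t _ (ih (t / 2))
    have h2 : Tendsto (fun p : ℕ × ℝ => cherryChar p.1 (p.2 / 4 ^ r)) (atTop ×ˢ 𝓝 t)
        (𝓝 (Real.exp (-(t / 4 ^ r) ^ 2 / 32) : ℝ)) := by
      have hdiv : Tendsto (fun p : ℕ × ℝ => p.2 / 4 ^ r) (atTop ×ˢ 𝓝 t) (𝓝 (t / 4 ^ r)) :=
        tendsto_snd.div_const _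
      have hpair : Tendsto (fun p : ℕ × ℝ => (p.1, p.2 / 4 ^ r)) (atTop ×ˢ 𝓝 t)
          (atTop ×ˢ 𝓝 (t / 4 ^ r)) := tendsto_fst.prodMk hdiv
      have h := (tendsto_cherryChar (t / 4 ^ r)).comp hpair
      simpa only [Function.comp_def] using h
    have h3 := h1.add (h2.mul_const
      ((Real.exp (-((4 ^ r - 1) / (3 * 16 ^ r)) * (t / 2) ^ 2 / 2) : ℝ) : ℂ))
    simp only [sub_add_cancel, zero_add] at h3
    rw [← Complex.ofReal_mul, ← Real.exp_add] at h3
    have hv : -(t / 4 ^ r) ^ 2 / 32 + -((4 ^ r - 1) / (3 * 16 ^ r)) * (t / 2) ^ 2 / 2 =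
        -((4 ^ (r + 1) - 1) / (3 * 16 ^ (r + 1))) * t ^ 2 / 2 := by
      rw [div_pow t, ← pow_mul, mul_comm r 2, pow_mul]
      norm_num [pow_succ]
      field_simp
      ring
    rw [hv] at h3
    have h4 : Tendsto (fun p : ℕ × ℝ => (p.1 - 2, p.2)) (atTop ×ˢ 𝓝 t) (atTop ×ˢ 𝓝 t) :=
      (tendsto_sub_atTop_nat 2).prodMap tendsto_id
    refine (h3.comp h4).congr' ?_
    have h : ∀ᶠ n : ℕ in atTop, 2 ≤ n := eventually_ge_atTop 2
    filter_upwards [h.prod_inl (𝓝 t)] with p hp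
    simp [Nat.sub_add_cancel hp]

/-- The law of a statistic of a uniform binary tree of magnitude `n`. -/
noncomputable def treeLaw (n : ℕ) (Y : BinTree → ℝ) : Measure ℝ :=
  ∑ τ ∈ treesOf n, ((treesOf n).card : ENNReal)⁻¹ • Measure.dirac (Y τ)

theorem isProbabilityMeasure_treeLaw (n : ℕ) (Y : BinTree → ℝ) :
    IsProbabilityMeasure (treeLaw (n + 1) Y) := by
  constructor
  have h : ((treesOf (n + 1)).card : ENNReal) ≠ 0 := by
    rw [card_treesOf_succ]
    exact_mod_cast (catalan_pos n).ne'
  simp only [treeLaw, Measure.coe_finsetSum, Finset.sum_apply, Measure.smul_apply, measure_univ,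
    smul_eq_mul, mul_one, Finset.sum_const, nsmul_eq_mul]
  exact ENNReal.mul_inv_cancel h (ENNReal.natCast_ne_top _)

theorem integral_treeLaw {E : Type*} [NormedAddCommGroup E] [NormedSpace ℝ E] [CompleteSpace E]
    (n : ℕ) (Y : BinTree → ℝ) (f : ℝ → E) :
    ∫ x, f x ∂treeLaw (n + 1) Y =
      ((treesOf (n + 1)).card : ℝ)⁻¹ • ∑ τ ∈ treesOf (n + 1), f (Y τ) := by
  have h : ((treesOf (n + 1)).card : ENNReal) ≠ 0 := by
    rw [card_treesOf_succ]
    exact_mod_cast (catalan_pos n).ne'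
  rw [treeLaw, integral_finsetSum_measure, Finset.smul_sum]
  · refine Finset.sum_congr rfl fun τ _ => ?_
    rw [integral_smul_measure, integral_dirac, ENNReal.toReal_inv, ENNReal.toReal_natCast]
  · intro τ _
    exact (integrable_dirac (by simp [enorm_lt_top])).smul_measure (ENNReal.inv_ne_top.2 h)

/-- CLT for the number of branches of general order `r ≥ 1`:
`√n (S_{r+1,n}/n − 1/4^r)` converges in distribution to `N(0, (4^r − 1)/(3·16^r))`. -/
theorem clt_branch_numbers (r : ℕ) (hr : 1 ≤ r) :
    ∀ f : BoundedContinuousFunction ℝ ℝ,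
      Tendsto (fun n : ℕ => expect n (fun τ =>
          f (Real.sqrt n * ((BinTree.branches (r+1) τ : ℝ) / n - 1 / 4 ^ r))))
        atTop (𝓝 (∫ x, f x ∂(gaussianReal 0
          (((4 : ℝ≥0) ^ r - 1) / (3 * (16 : ℝ≥0) ^ r))))) := by
  have hprob : ∀ n : ℕ, IsProbabilityMeasure (treeLaw (n + 1) fun τ =>
      √(n + 1 : ℕ) * ((BinTree.branches (r + 1) τ : ℝ) / (n + 1 : ℕ) - 1 / 4 ^ r)) :=
    fun n => isProbabilityMeasure_treeLaw n _
  let μ : ℕ → ProbabilityMeasure ℝ := fun n => ⟨treeLaw (n + 1) fun τ =>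
    √(n + 1 : ℕ) * ((BinTree.branches (r + 1) τ : ℝ) / (n + 1 : ℕ) - 1 / 4 ^ r), hprob n⟩
  let ν : ProbabilityMeasure ℝ :=
    ⟨gaussianReal 0 (((4 : ℝ≥0) ^ r - 1) / (3 * (16 : ℝ≥0) ^ r)), inferInstance⟩
  have hlim : Tendsto μ atTop (𝓝 ν) := by
    refine ProbabilityMeasure.tendsto_iff_tendsto_charFun.2 fun t => ?_
    have hchar : ∀ n, charFun (μ n : Measure ℝ) t = branchChar r (n + 1) t := fun n => by
      rw [charFun_apply_real, show (μ n : Measure ℝ) = treeLaw (n + 1) _ from rfl,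
        integral_treeLaw, branchChar, Complex.real_smul, mul_comm, Complex.ofReal_inv,
        Complex.ofReal_natCast, ← div_eq_mul_inv]
      congr 1
      refine Finset.sum_congr (M := ℂ) rfl fun τ _ => ?_
      congr 1
      push_cast
      ring
    have hgauss : charFun (ν : Measure ℝ) t =
        (Real.exp (-((4 ^ r - 1) / (3 * 16 ^ r)) * t ^ 2 / 2) : ℝ) := by
      change charFun (gaussianReal 0 _) t = _
      rw [charFun_gaussianReal]
      have h1 : (1 : ℝ≥0) ≤ 4 ^ r := one_le_pow₀ (by norm_num)
      rw [NNReal.coe_div, NNReal.coe_sub h1]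
      push_cast
      congr 1
      ring
    simp only [hchar, hgauss]
    have ht : Tendsto (fun n : ℕ => (n + 1, t)) atTop (atTop ×ˢ 𝓝 t) :=
      (tendsto_add_atTop_nat 1).prodMk tendsto_const_nhds
    have h := (tendsto_branchChar r t).comp ht
    simpa only [Function.comp_def] using h
  intro f
  rw [← tendsto_add_atTop_iff_nat 1]
  refine ((ProbabilityMeasure.tendsto_iff_forall_integral_tendsto.1 hlim) f).congr fun n => ?_
  rw [show (μ n : Measure ℝ) = treeLaw (n + 1) _ from rfl, integral_treeLaw, expect, smul_eq_mul]
  exact inv_mul_eq_div _ _
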